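/- Let f ∈ C_0(ℝ^d) and F(γ) := e^{⟨f,γ⟩}. Then ∫_Γ (H_0^+ F)(γ)² μ(dγ) = ∫_{ℝ^d}∫_{ℝ^d} z² (e^{f(x_1)} − 1)(e^{f(x_2)} − 1) (∫_Γ exp[(s−1)E(x_1,γ) + (s−1)E(x_2,γ) + ⟨2f,γ⟩] μ(dγ)) dx_1 dx_2. -/

import Mathlib

open MeasureTheory Set Filter
open scoped ENNReal NNReal BigOperators Topology Classical

noncomputable section

abbrev EucSp (d : ℕ) := EuclideanSpace ℝ (Fin d)

/-- The configuration space `Γ` over `ℝ^d`: locally finite subsets. -/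
def Config (d : ℕ) : Type :=
  {γ : Set (EucSp d) // ∀ Λ : Set (EucSp d), IsCompact Λ → (γ ∩ Λ).Finite}

/-- The σ-algebra on `Γ` generated by the maps `γ ↦ |γ ∩ B|`, `B` Borel. -/
instance Config.instMS (d : ℕ) : MeasurableSpace (Config d) :=
  ⨆ (B : Set (EucSp d)) (_ : MeasurableSet B),
    MeasurableSpace.comap (fun γ : Config d => (γ.1 ∩ B).encard) (⊤ : MeasurableSpace ℕ∞)

/-- `γ ∪ {x}`. -/
def Config.ins {d : ℕ} (γ : Config d) (x : EucSp d) : Config d :=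
  ⟨insert x γ.1, fun Λ hΛ => ((γ.2 Λ hΛ).insert x).subset fun y hy => by
    rcases hy with ⟨h1, h2⟩
    rcases h1 with rfl | h1
    · exact Set.mem_insert _ _
    · exact Set.mem_insert_of_mem _ ⟨h1, h2⟩⟩

/-- `γ ∖ {x}`. -/
def Config.del {d : ℕ} (γ : Config d) (x : EucSp d) : Config d :=
  ⟨γ.1 \ {x}, fun Λ hΛ => (γ.2 Λ hΛ).subset fun y hy => ⟨hy.1.1, hy.2⟩⟩

/-- The pairing `⟨f, γ⟩ = ∑_{x ∈ γ} f x`. -/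
def cpair {d : ℕ} (f : EucSp d → ℝ) (γ : Config d) : ℝ := ∑' x : γ.1, f x.1

/-- `exp : [-∞,∞] → [0,∞]`. -/
def eexp (x : EReal) : ℝ≥0∞ :=
  if x = ⊤ then ⊤ else if x = ⊥ then 0 else ENNReal.ofReal (Real.exp x.toReal)

/-- real-valued exponential of an extended real (with `exp(±∞)` sent to junk value `0`). -/
def rexp (x : EReal) : ℝ := (eexp x).toReal

/-- The relative energy `E(x,γ) = ∑_{y ∈ γ} φ(x-y)` if absolutely convergent, `+∞` otherwise. -/
def energy {d : ℕ} (φ : EucSp d → EReal) (x : EucSp d) (γ : Set (EucSp d)) : EReal :=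
  if (∀ y ∈ γ, φ (x - y) ≠ ⊤) ∧ Summable (fun y : γ => (φ (x - y.1)).toReal)
  then (((∑' y : γ, (φ (x - y.1)).toReal) : ℝ) : EReal)
  else ⊤

/-- `∑_{u ∈ γ} φ(u)` if absolutely convergent, `+∞` otherwise. -/
def totPhi {d : ℕ} (φ : EucSp d → EReal) (γ : Set (EucSp d)) : EReal :=
  if (∀ y ∈ γ, φ y ≠ ⊤) ∧ Summable (fun y : γ => (φ y.1).toReal)
  then (((∑' y : γ, (φ y.1).toReal) : ℝ) : EReal)
  else ⊤

/-- A pair potential: Borel, even, with `φ(x) ∈ ℝ` off the origin. -/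
structure IsPairPotential {d : ℕ} (φ : EucSp d → EReal) : Prop where
  meas : Measurable φ
  even : ∀ x : EucSp d, x ≠ 0 → φ (-x) = φ x
  finite_off : ∀ x : EucSp d, x ≠ 0 → φ x ≠ ⊤
  ne_bot : ∀ x, φ x ≠ ⊥

/-- Stability (S): `∑_{{x,y} ⊆ η} φ(x-y) ≥ -B|η|` for all finite `η`
(stated with the sum over ordered pairs, which doubles both sides). -/
def Stable {d : ℕ} (φ : EucSp d → EReal) (B : ℝ) : Prop :=
  ∀ η : Finset (EucSp d),
    ((-(2 * B * η.card) : ℝ) : EReal) ≤ ∑ p ∈ η.offDiag, φ (p.1 - p.2)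

/-- Low activity–high temperature (LA-HT): `∫ |e^{-φ} - 1| z dx < (2 e^{1+2B})⁻¹`. -/
def LAHT {d : ℕ} (φ : EucSp d → EReal) (z B : ℝ) : Prop :=
  ∫⁻ x : EucSp d, ENNReal.ofReal (|rexp (-(φ x)) - 1| * z)
    < ENNReal.ofReal (2 * Real.exp (1 + 2 * B))⁻¹

/-- The Georgii–Nguyen–Zessin identity characterizing `μ ∈ G(z,φ)`. -/
def GNZ {d : ℕ} (z : ℝ) (φ : EucSp d → EReal) (μ : Measure (Config d)) : Prop :=
  ∀ F : Config d → EucSp d → ℝ≥0∞,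
    Measurable (Function.uncurry F) →
    ∫⁻ γ, ∑' x : γ.1, F γ x.1 ∂μ
      = ∫⁻ γ, ∫⁻ x, ENNReal.ofReal z * eexp (-(energy φ x γ.1)) * F (γ.ins x) x ∂volume ∂μ


/-- Ordered `n`-tuples of distinct points of `γ`. -/
def injTuples {d : ℕ} (n : ℕ) (γ : Set (EucSp d)) : Set (Fin n → EucSp d) :=
  {p | Function.Injective p ∧ ∀ i, p i ∈ γ}

/-- `(k_μ^{(n)})` is the family of correlation functions of `μ`: each `k n` is measurable,
nonnegative and symmetric, and for every measurable symmetric `f : (ℝ^d)^n → [0,∞]`,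
`∫_Γ ∑_{{x_1,…,x_n} ⊆ γ} f dμ = (1/n!) ∫ f·kₙ dx` (stated equivalently via the sum over
ordered tuples of distinct points, which absorbs the factor `1/n!`). -/
def HasCorrFns {d : ℕ} (μ : Measure (Config d)) (k : ∀ n : ℕ, (Fin n → EucSp d) → ℝ) : Prop :=
  (∀ n : ℕ, Measurable (k n) ∧ (∀ x, 0 ≤ k n x) ∧
      ∀ (σ : Equiv.Perm (Fin n)) (x : Fin n → EucSp d), k n (x ∘ σ) = k n x) ∧
  ∀ n : ℕ, 0 < n → ∀ f : (Fin n → EucSp d) → ℝ≥0∞, Measurable f →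
    (∀ (σ : Equiv.Perm (Fin n)) (x : Fin n → EucSp d), f (x ∘ σ) = f x) →
    ∫⁻ γ, ∑' p : injTuples n γ.1, f p.1 ∂μ
      = ∫⁻ x : Fin n → EucSp d, f x * ENNReal.ofReal (k n x)

/-- The Ruelle bound `k^{(n)} ≤ ξⁿ`. -/
def RuelleBound {d : ℕ} (k : ∀ n : ℕ, (Fin n → EucSp d) → ℝ) (ξ : ℝ) : Prop :=
  ∀ n : ℕ, 0 < n → ∀ x : Fin n → EucSp d, k n x ≤ ξ ^ n

/-- Translation invariance of a family of functions on tuples. -/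
def TransInvFns {d : ℕ} (k : ∀ n : ℕ, (Fin n → EucSp d) → ℝ) : Prop :=
  ∀ (n : ℕ) (a : EucSp d) (x : Fin n → EucSp d), k n (fun i => x i + a) = k n x

/-- `P` is a partition of `{0,…,n-1}` into nonempty pairwise disjoint blocks. -/
def IsPartOfUniv {n : ℕ} (P : Finset (Finset (Fin n))) : Prop :=
  (∀ b ∈ P, b.Nonempty) ∧ (P : Set (Finset (Fin n))).PairwiseDisjoint id ∧
    P.sup id = Finset.univ

/-- `u` is the family of Ursell functions of `k`:
`k(η) = ∑ u(η_1) ⋯ u(η_j)`, summing over all partitions of `η`. -/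
def IsUrsell {d : ℕ} (k u : ∀ n : ℕ, (Fin n → EucSp d) → ℝ) : Prop :=
  ∀ n : ℕ, 0 < n → ∀ x : Fin n → EucSp d,
    k n x = ∑ P : Finset (Finset (Fin n)),
      if IsPartOfUniv P then ∏ b ∈ P, u b.card (fun i => x (b.orderIsoOfFin rfl i).1) else 0

/-- `f ∈ C_0(ℝ^d)`: continuous with compact support. -/
def IsC0 {d : ℕ} (f : EucSp d → ℝ) : Prop := Continuous f ∧ HasCompactSupport f

/-- Cylinder functions `FC_b(C_0(ℝ^d),Γ)`. -/
def Cyl {d : ℕ} (F : Config d → ℝ) : Prop :=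
  ∃ (N : ℕ) (f : Fin N → EucSp d → ℝ) (g : (Fin N → ℝ) → ℝ),
    (∀ i, IsC0 (f i)) ∧ Continuous g ∧ (∃ C, ∀ y, |g y| ≤ C) ∧
    ∀ γ, F γ = g fun i => cpair (f i) γ

/-- `(D_x^- F)(γ) = F(γ∖x) - F(γ)`. -/
def Dminus {d : ℕ} (F : Config d → ℝ) (x : EucSp d) (γ : Config d) : ℝ := F (γ.del x) - F γ

/-- `(D_x^+ F)(γ) = F(γ∪x) - F(γ)`. -/
def Dplus {d : ℕ} (F : Config d → ℝ) (x : EucSp d) (γ : Config d) : ℝ := F (γ.ins x) - F γ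

/-- `(D_{xy}^{-+} F)(γ) = F(γ∖x∪y) - F(γ)`. -/
def Dpm {d : ℕ} (F : Config d → ℝ) (x y : EucSp d) (γ : Config d) : ℝ :=
  F ((γ.del x).ins y) - F γ

/-- The Glauber bilinear form `E_G`. -/
def glauberForm {d : ℕ} (s : ℝ) (φ : EucSp d → EReal) (μ : Measure (Config d))
    (F G : Config d → ℝ) : ℝ :=
  ∫ γ, (∑' x : γ.1,
      rexp ((s : EReal) * energy φ x.1 (γ.1 \ {x.1})) * Dminus F x.1 γ * Dminus G x.1 γ) ∂μ

/-- The Kawasaki bilinear form `E_K`. -/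
def kawasakiForm {d : ℕ} (s : ℝ) (a : EucSp d → ℝ) (φ : EucSp d → EReal)
    (μ : Measure (Config d)) (F G : Config d → ℝ) : ℝ :=
  (1 / 2) * ∫ γ, (∑' x : γ.1, ∫ y : EucSp d,
      a (x.1 - y) *
        rexp ((s : EReal) * energy φ x.1 (γ.1 \ {x.1}) +
          ((s - 1 : ℝ) : EReal) * energy φ y (γ.1 \ {x.1})) *
        Dpm F x.1 y γ * Dpm G x.1 y γ) ∂μ

/-- The Glauber generator `H_G`. -/
def HG {d : ℕ} (s z : ℝ) (φ : EucSp d → EReal) (F : Config d → ℝ) (γ : Config d) : ℝ :=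
  -(∑' x : γ.1, rexp ((s : EReal) * energy φ x.1 (γ.1 \ {x.1})) * Dminus F x.1 γ)
    - ∫ x : EucSp d, z * rexp (((s - 1 : ℝ) : EReal) * energy φ x γ.1) * Dplus F x γ

/-- The Kawasaki generator `H_K`. -/
def HK {d : ℕ} (s : ℝ) (a : EucSp d → ℝ) (φ : EucSp d → EReal) (F : Config d → ℝ)
    (γ : Config d) : ℝ :=
  -(∑' x : γ.1, ∫ y : EucSp d,
      a (x.1 - y) * rexp ((s : EReal) * energy φ x.1 (γ.1 \ {x.1}) +
        ((s - 1 : ℝ) : EReal) * energy φ y (γ.1 \ {x.1})) * Dpm F x.1 y γ)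

/-- The scaled jump kernel `a_ε(x) = ε^d a(ε x)`. -/
def aScaled {d : ℕ} (a : EucSp d → ℝ) (ε : ℝ) (x : EucSp d) : ℝ := ε ^ d * a (ε • x)

/-- `H_ε^-` (death part of the Kawasaki generator with kernel `aa`). -/
def HepsMinus {d : ℕ} (s : ℝ) (aa : EucSp d → ℝ) (φ : EucSp d → EReal)
    (F : Config d → ℝ) (γ : Config d) : ℝ :=
  -(∑' x : γ.1, Dminus F x.1 γ * ∫ y : EucSp d,
      aa (x.1 - y) * rexp ((s : EReal) * energy φ x.1 (γ.1 \ {x.1}) +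
        ((s - 1 : ℝ) : EReal) * energy φ y (γ.1 \ {x.1})))

/-- `H_ε^+` (birth part of the Kawasaki generator with kernel `aa`). -/
def HepsPlus {d : ℕ} (s : ℝ) (aa : EucSp d → ℝ) (φ : EucSp d → EReal)
    (F : Config d → ℝ) (γ : Config d) : ℝ :=
  -(∑' x : γ.1, ∫ y : EucSp d,
      aa (x.1 - y) * rexp ((s : EReal) * energy φ x.1 (γ.1 \ {x.1}) +
        ((s - 1 : ℝ) : EReal) * energy φ y (γ.1 \ {x.1})) * Dplus F y (γ.del x.1))

/-- `H_0^-` (death part of the Glauber generator). -/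
def H0Minus {d : ℕ} (s : ℝ) (φ : EucSp d → EReal) (F : Config d → ℝ) (γ : Config d) : ℝ :=
  -(∑' x : γ.1, rexp ((s : EReal) * energy φ x.1 (γ.1 \ {x.1})) * Dminus F x.1 γ)

/-- `H_0^+` (birth part of the Glauber generator). -/
def H0Plus {d : ℕ} (s z : ℝ) (φ : EucSp d → EReal) (F : Config d → ℝ) (γ : Config d) : ℝ :=
  -∫ x : EucSp d, z * rexp (((s - 1 : ℝ) : EReal) * energy φ x γ.1) * Dplus F x γ

/-- The standing assumptions of the paper: `s ∈ [0,1/2]`, a stable pair potential in the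
low activity–high temperature regime, bounded outside a ball, and `μ` the Gibbs measure
from Ruelle's theorem with its correlation and Ursell functions. -/
structure Setting (d : ℕ) (s z B ξ : ℝ) (φ : EucSp d → EReal) (μ : Measure (Config d))
    (k u : ∀ n : ℕ, (Fin n → EucSp d) → ℝ) : Prop where
  hd : 0 < d
  hs0 : 0 ≤ s
  hs1 : s ≤ 1 / 2
  pp : IsPairPotential φ
  hB : 0 ≤ B
  stable : Stable φ B
  hz : 0 < z
  laht : LAHT φ z B
  bddOutside : ∃ R C : ℝ, ∀ x : EucSp d, R ≤ ‖x‖ → ∃ r : ℝ, φ x = (r : EReal) ∧ |r| ≤ C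
  prob : IsProbabilityMeasure μ
  gnz : GNZ z φ μ
  corr : HasCorrFns μ k
  ti : TransInvFns k
  hξ : 0 < ξ
  ruelle : RuelleBound k ξ
  ursell : IsUrsell k u
  ursellInt : ∀ m : ℕ,
    Integrable (fun y : Fin (m + 1) → EucSp d => u (m + 2) (Fin.cons 0 y)) volume

/-- The jump kernel `a`: bounded, nonnegative, even, integrable. -/
structure GoodA {d : ℕ} (a : EucSp d → ℝ) : Prop where
  meas : Measurable a
  nonneg : ∀ x, 0 ≤ a x
  bdd : ∃ C, ∀ x, a x ≤ C
  even : ∀ x, a (-x) = a x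
  int : Integrable a volume

/-- `φ(x) → 0` as `|x| → ∞`. -/
def PhiVanishes {d : ℕ} (φ : EucSp d → EReal) : Prop :=
  Tendsto φ (cocompact (EucSp d)) (nhds (0 : EReal))

/-- The normalization `∫ a dx = (∫_Γ exp[(s-1) ∑_{u∈γ} φ(u)] dμ(γ))⁻¹`. -/
def NormalizedA {d : ℕ} (s : ℝ) (a : EucSp d → ℝ) (φ : EucSp d → EReal)
    (μ : Measure (Config d)) : Prop :=
  (∫ x : EucSp d, a x) = (∫ γ, rexp (((s - 1 : ℝ) : EReal) * totPhi φ γ.1) ∂μ)⁻¹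


namespace Config

variable {d : ℕ}

theorem countable (γ : Config d) : γ.1.Countable := by
  have h : γ.1 = ⋃ n : ℕ, γ.1 ∩ Metric.closedBall 0 n := by
    rw [← Set.inter_iUnion, Metric.iUnion_closedBall_nat, Set.inter_univ]
  rw [h]
  exact Set.countable_iUnion fun n => (γ.2 _ (isCompact_closedBall 0 _)).countable

instance (γ : Config d) : Countable γ.1 := γ.countable.to_subtype

theorem measurable_encard {A : Set (EucSp d)} (hA : MeasurableSet A) :
    Measurable fun γ : Config d => ((γ.1 ∩ A).encard : ℝ≥0∞) := by
  have h : Measurable[_, ⊤] fun γ : Config d => (γ.1 ∩ A).encard :=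
    Measurable.of_comap_le (le_iSup₂_of_le A hA le_rfl)
  exact Measurable.comp (measurable_from_top (f := fun n : ℕ∞ => (n : ℝ≥0∞))) h

/-- The `n`-th bounded shell of `ℝ^d`. -/
def shell (d n : ℕ) : Set (EucSp d) := disjointed (fun n : ℕ => Metric.closedBall 0 n) n

theorem measurableSet_shell (n : ℕ) : MeasurableSet (shell d n) :=
  MeasurableSet.disjointed (fun _ => Metric.isClosed_closedBall.measurableSet) n

theorem finite_inter_shell (γ : Config d) (n : ℕ) : (γ.1 ∩ shell d n).Finite :=
  (γ.2 _ (isCompact_closedBall 0 n)).subset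
    (Set.inter_subset_inter_right _ (disjointed_subset _ n))

theorem iUnion_shell : ⋃ n, shell d n = Set.univ := by
  unfold shell
  rw [iUnion_disjointed, Metric.iUnion_closedBall_nat]

/-- Counting measure on `γ` inside a shell, normalised to have mass at most one. -/
def shellMeasure (n : ℕ) (γ : Config d) : Measure (EucSp d) :=
  (1 + ((γ.1 ∩ shell d n).encard : ℝ≥0∞))⁻¹ • Measure.count.restrict (γ.1 ∩ shell d n)

theorem measurable_shellMeasure (n : ℕ) : Measurable (shellMeasure (d := d) n) := by
  refine Measure.measurable_of_measurable_coe _ fun A hA => ?_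
  have h : ∀ γ : Config d, shellMeasure n γ A
      = (1 + ((γ.1 ∩ shell d n).encard : ℝ≥0∞))⁻¹ * ((γ.1 ∩ (shell d n ∩ A)).encard : ℝ≥0∞) := by
    intro γ
    have hm := (γ.finite_inter_shell n).measurableSet
    rw [shellMeasure, Measure.smul_apply, Measure.restrict_apply hA,
      Measure.count_apply (hA.inter hm), smul_eq_mul, Set.inter_comm A, Set.inter_assoc]
  simp_rw [h]
  exact ((measurable_encard (measurableSet_shell n)).const_add 1).inv.mul
    (measurable_encard ((measurableSet_shell n).inter hA))

/-- The kernel given by `shellMeasure`. -/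
def shellKernel (d n : ℕ) : ProbabilityTheory.Kernel (Config d) (EucSp d) :=
  ⟨shellMeasure n, measurable_shellMeasure n⟩

instance (n : ℕ) : ProbabilityTheory.IsFiniteKernel (shellKernel d n) := by
  refine ⟨1, ENNReal.one_lt_top, fun γ => ?_⟩
  have hm := (γ.finite_inter_shell n).measurableSet
  change shellMeasure n γ Set.univ ≤ 1
  rw [shellMeasure, Measure.smul_apply, Measure.restrict_apply MeasurableSet.univ,
      Set.univ_inter, Measure.count_apply hm, smul_eq_mul]
  rw [mul_comm, ← div_eq_mul_inv]
  exact ENNReal.div_le_of_le_mul (by rw [one_mul]; exact le_add_self)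

theorem tsum_eq_shells (γ : Config d) (g : EucSp d → ℝ≥0∞) :
    ∑' y : γ.1, g y = ∑' n, (1 + ((γ.1 ∩ shell d n).encard : ℝ≥0∞)) *
      ∫⁻ y, g y ∂shellKernel d n γ := by
  have h1 : ∑' y : γ.1, g y = ∫⁻ y in γ.1, g y ∂Measure.count := by
    rw [← lintegral_indicator γ.countable.measurableSet, lintegral_count, tsum_subtype]
  have h2 : γ.1 = ⋃ n, γ.1 ∩ shell d n := by
    rw [← Set.inter_iUnion, iUnion_shell, Set.inter_univ]
  rw [h1, h2, lintegral_iUnion (fun n => (γ.finite_inter_shell n).measurableSet)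
    (fun i j hij => (disjoint_disjointed _ hij).mono Set.inter_subset_right
      Set.inter_subset_right), ← h2]
  refine tsum_congr fun n => ?_
  change _ = _ * ∫⁻ y, g y ∂shellMeasure n γ
  rw [shellMeasure, lintegral_smul_measure, smul_eq_mul, ← mul_assoc, ENNReal.mul_inv_cancel,
    one_mul]
  · simp
  · have := (γ.finite_inter_shell n).encard_lt_top.ne
    simp [this]

theorem measurable_tsum {X : Type*} [MeasurableSpace X] {g : X → EucSp d → ℝ≥0∞}
    (hg : Measurable (Function.uncurry g)) :
    Measurable fun p : X × Config d => ∑' y : p.2.1, g p.1 y := by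
  have h : ∀ p : X × Config d, ∑' y : p.2.1, g p.1 y
      = ∑' n, (1 + ((p.2.1 ∩ shell d n).encard : ℝ≥0∞)) *
        ∫⁻ y, g p.1 y ∂(shellKernel d n).prodMkLeft X p := fun p =>
    tsum_eq_shells p.2 (g p.1)
  simp_rw [h]
  refine Measurable.tsum fun n => ?_
  refine Measurable.mul
    (((measurable_encard (measurableSet_shell n)).comp measurable_snd).const_add 1) ?_
  refine Measurable.lintegral_kernel_prod_right (f := fun (p : X × Config d) y => g p.1 y) ?_
  exact hg.comp ((measurable_fst.comp measurable_fst).prodMk measurable_snd)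

theorem measurable_tsum_tuples (n : ℕ) {X : Type*} [MeasurableSpace X]
    {g : X → (Fin n → EucSp d) → ℝ≥0∞} (hg : Measurable (Function.uncurry g)) :
    Measurable fun p : X × Config d => ∑' q : Fin n → p.2.1, g p.1 (fun i => q i) := by
  induction n generalizing X with
  | zero =>
    simp only [tsum_fintype, Finset.univ_unique, Finset.sum_singleton]
    have h : ∀ p : X × Config d, (fun i => ((default : Fin 0 → p.2.1) i : EucSp d)) = Fin.elim0 :=
      fun p => Subsingleton.elim _ _
    simp_rw [h]
    exact hg.comp (measurable_fst.prodMk measurable_const)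
  | succ n ih =>
    have h : ∀ p : X × Config d, ∑' q : Fin (n + 1) → p.2.1, g p.1 (fun i => q i)
        = ∑' y : p.2.1, ∑' q : Fin n → p.2.1,
          g p.1 (Fin.cons (α := fun _ => EucSp d) (y : EucSp d) (fun i => (q i : EucSp d))) := by
      intro p
      rw [← (Fin.consEquiv fun _ => p.2.1).tsum_eq, ENNReal.tsum_prod']
      refine tsum_congr fun y => tsum_congr fun q => ?_
      congr 1
      ext i : 1
      refine Fin.cases ?_ (fun i => ?_) i <;> simp [Fin.consEquiv]
    simp_rw [h]
    have hc : Measurable (Function.uncurry fun (x : X × EucSp d) (q : Fin n → EucSp d) =>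
        g x.1 (Fin.cons (α := fun _ => EucSp d) x.2 q)) := by
      refine hg.comp (Measurable.prodMk (by fun_prop) ?_)
      refine measurable_pi_lambda _ fun i => ?_
      refine Fin.cases ?_ (fun i => ?_) i
      · change Measurable fun c : (X × EucSp d) × (Fin n → EucSp d) => c.1.2
        fun_prop
      · change Measurable fun c : (X × EucSp d) × (Fin n → EucSp d) => c.2 i
        fun_prop
    have h3 := ih hc
    have h4 := measurable_tsum (X := X × Config d)
      (g := fun x y => ∑' q : Fin n → x.2.1,
        g x.1 (Fin.cons (α := fun _ => EucSp d) y (fun i => (q i : EucSp d))))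
      (h3.comp (g := fun x : (X × EucSp d) × Config d => ∑' q : Fin n → x.2.1,
        g x.1.1 (Fin.cons (α := fun _ => EucSp d) x.1.2 (fun i => (q i : EucSp d))))
        (f := fun x : (X × Config d) × EucSp d => ((x.1.1, x.2), x.1.2)) (by fun_prop))
    exact h4.comp (f := fun p : X × Config d => (p, p.2)) (by fun_prop)

theorem tsum_injTuples (n : ℕ) (γ : Config d) (g : (Fin n → EucSp d) → ℝ≥0∞) :
    ∑' p : injTuples n γ.1, g p.1
      = ∑' q : Fin n → γ.1, {p | Function.Injective p}.indicator g (fun i => (q i : EucSp d)) := by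
  let e : {q : Fin n → γ.1 // Function.Injective q} ≃ injTuples n γ.1 :=
    { toFun := fun q => ⟨fun i => q.1 i, Subtype.val_injective.comp q.2, fun i => (q.1 i).2⟩
      invFun := fun p => ⟨fun i => ⟨p.1 i, p.2.2 i⟩, fun i j h => p.2.1 (congrArg Subtype.val h)⟩
      left_inv := fun _ => rfl
      right_inv := fun _ => rfl }
  rw [← e.tsum_eq]
  refine (tsum_subtype {q : Fin n → γ.1 | Function.Injective q}
    (fun q => g fun i => (q i : EucSp d))).trans (tsum_congr fun q => ?_)
  have : Function.Injective (fun i => (q i : EucSp d)) ↔ Function.Injective q :=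
    ⟨fun h i j hij => h (congrArg Subtype.val hij), fun h => Subtype.val_injective.comp h⟩
  by_cases hq : Function.Injective q
  · rw [Set.indicator_of_mem (by exact hq), Set.indicator_of_mem (by exact this.2 hq)]
  · rw [Set.indicator_of_notMem (by exact hq), Set.indicator_of_notMem (by exact mt this.1 hq)]

theorem measurableSet_injective (n : ℕ) :
    MeasurableSet {p : Fin n → EucSp d | Function.Injective p} := by
  have h : {p : Fin n → EucSp d | Function.Injective p}
      = ⋂ (i : Fin n) (j : Fin n) (_ : i ≠ j), {p | p i = p j}ᶜ := by
    ext p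
    simp only [Set.mem_ofPred_eq, Set.mem_iInter, Set.mem_compl_iff]
    exact ⟨fun h i j hij e => hij (h e), fun h i j e => by_contra fun hij => h i j hij e⟩
  rw [h]
  exact MeasurableSet.iInter fun i => MeasurableSet.iInter fun j => MeasurableSet.iInter fun _ =>
    (measurableSet_eq_fun (measurable_pi_apply i) (measurable_pi_apply j)).compl

theorem measurable_tsum_injTuples (n : ℕ) {g : (Fin n → EucSp d) → ℝ≥0∞} (hg : Measurable g) :
    Measurable fun γ : Config d => ∑' p : injTuples n γ.1, g p.1 := by
  simp_rw [tsum_injTuples]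
  exact (measurable_tsum_tuples n (X := Unit)
    (g := fun _ p => {p | Function.Injective p}.indicator g p)
    ((hg.indicator (measurableSet_injective n)).comp measurable_snd)).comp
    ((measurable_const (a := ())).prodMk measurable_id)

/-- Finite products over subsets of a configuration are dominated by the sum over tuples. -/
theorem prod_one_add_le (γ : Config d) (h : EucSp d → ℝ≥0∞) (η : Finset γ.1) :
    ∏ y ∈ η, (1 + h y)
      ≤ ∑' n : ℕ, (n.factorial : ℝ≥0∞)⁻¹ * ∑' p : injTuples n γ.1, ∏ i, h (p.1 i) := by
  have key : ∀ n : ℕ, ∑ t ∈ Finset.powersetCard n η, ∏ y ∈ t, h y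
      ≤ (n.factorial : ℝ≥0∞)⁻¹ * ∑' p : injTuples n γ.1, ∏ i, h (p.1 i) := by
    intro n
    have hn0 : (n.factorial : ℝ≥0∞) ≠ 0 := by exact_mod_cast n.factorial_ne_zero
    have hnt : (n.factorial : ℝ≥0∞) ≠ ⊤ := ENNReal.natCast_ne_top _
    rw [← one_mul (∑ t ∈ _, _), ← ENNReal.inv_mul_cancel hn0 hnt, mul_assoc]
    gcongr
    let e : ∀ t : Finset.powersetCard n η, Fin n ≃ t.1 := fun t =>
      (Finset.equivFinOfCardEq (Finset.mem_powersetCard.1 t.2).2).symm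
    let F : Finset.powersetCard n η × Equiv.Perm (Fin n) → injTuples n γ.1 := fun x =>
      ⟨fun i => (e x.1 (x.2 i)).1.1, fun i j hij => by
        simpa [Subtype.ext_iff.symm] using hij, fun i => (e x.1 (x.2 i)).1.2⟩
    have hF : Function.Injective F := by
      rintro ⟨t, σ⟩ ⟨t', σ'⟩ hx
      have hx' : ∀ i, (e t (σ i)).1 = (e t' (σ' i)).1 := fun i =>
        Subtype.ext (congrFun (congrArg Subtype.val hx) i)
      have ht : t = t' := by
        refine Subtype.ext (Finset.eq_of_subset_of_card_le (fun y hy => ?_) ?_)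
        · have := hx' (σ.symm ((e t).symm ⟨y, hy⟩))
          simp only [Equiv.apply_symm_apply] at this
          rw [this]
          exact (e t' _).2
        · rw [(Finset.mem_powersetCard.1 t.2).2, (Finset.mem_powersetCard.1 t'.2).2]
      subst ht
      refine Prod.ext rfl (Equiv.ext fun i => (e t).injective (Subtype.ext (hx' i)))
    refine le_trans (le_of_eq ?_) (ENNReal.tsum_comp_le_tsum_of_injective hF _)
    rw [ENNReal.tsum_prod', tsum_fintype, Finset.mul_sum, ← Finset.sum_coe_sort]
    refine Finset.sum_congr rfl fun t _ => ?_
    have hp : ∀ σ : Equiv.Perm (Fin n), ∏ i, h ((F (t, σ)).1 i) = ∏ y ∈ t.1, h y := by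
      intro σ
      change ∏ i, h (e t (σ i)).1.1 = _
      rw [Equiv.prod_comp σ fun i => h (e t i).1.1, Equiv.prod_comp (e t) fun y => h y.1.1,
        Finset.prod_coe_sort t.1 fun y => h y]
    simp_rw [hp]
    rw [tsum_fintype, Finset.sum_const, Finset.card_univ, Fintype.card_perm, Fintype.card_fin,
      nsmul_eq_mul]
  rw [Finset.prod_one_add, Finset.sum_powerset]
  exact (Finset.sum_le_sum fun n _ => key n).trans (ENNReal.sum_le_tsum _)

end Config

namespace Config

variable {d : ℕ}

theorem summable_iff_tsum_enorm {ι : Type*} {g : ι → ℝ} :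
    Summable g ↔ ∑' i, ‖g i‖ₑ ≠ ⊤ := by
  rw [tsum_enorm_ne_top_iff_summable_norm, summable_norm_iff]

theorem tsum_eq_toReal_sub {ι : Type*} {g : ι → ℝ} (hg : Summable g) :
    ∑' i, g i = (∑' i, ENNReal.ofReal (g i)).toReal - (∑' i, ENNReal.ofReal (-g i)).toReal := by
  rw [ENNReal.tsum_toReal_eq fun _ => ENNReal.ofReal_ne_top,
    ENNReal.tsum_toReal_eq fun _ => ENNReal.ofReal_ne_top, ← Summable.tsum_sub]
  · refine tsum_congr fun i => ?_
    rw [ENNReal.toReal_ofReal', ENNReal.toReal_ofReal']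
    exact (max_zero_sub_max_neg_zero_eq_self (g i)).symm
  · refine Summable.of_norm_bounded hg.norm fun i => ?_
    rw [ENNReal.toReal_ofReal', Real.norm_eq_abs, Real.norm_eq_abs,
      abs_of_nonneg (le_max_right _ _)]
    exact max_le (le_abs_self _) (abs_nonneg _)
  · refine Summable.of_norm_bounded hg.norm fun i => ?_
    rw [ENNReal.toReal_ofReal', Real.norm_eq_abs, Real.norm_eq_abs,
      abs_of_nonneg (le_max_right _ _)]
    exact max_le (neg_le_abs _) (abs_nonneg _)

section Measurability

variable {X : Type*} [MeasurableSpace X] {g : X → EucSp d → ℝ}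

theorem measurableSet_summable (hg : Measurable (Function.uncurry g)) :
    MeasurableSet {p : X × Config d | Summable fun y : p.2.1 => g p.1 y} := by
  simp_rw [summable_iff_tsum_enorm]
  exact (measurable_tsum (g := fun a y => ‖g a y‖ₑ) hg.enorm (measurableSet_singleton ⊤)).compl

theorem measurable_real_tsum (hg : Measurable (Function.uncurry g)) :
    Measurable fun p : X × Config d => ∑' y : p.2.1, g p.1 y := by
  have h : (fun p : X × Config d => ∑' y : p.2.1, g p.1 y)
      = {p : X × Config d | Summable fun y : p.2.1 => g p.1 y}.indicator fun p =>
        (∑' y : p.2.1, ENNReal.ofReal (g p.1 y)).toReal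
          - (∑' y : p.2.1, ENNReal.ofReal (-g p.1 y)).toReal := by
    ext p
    by_cases hp : Summable fun y : p.2.1 => g p.1 y
    · rw [Set.indicator_of_mem (by exact hp), tsum_eq_toReal_sub hp]
    · rw [Set.indicator_of_notMem (by exact hp), tsum_eq_zero_of_not_summable hp]
  rw [h]
  refine Measurable.indicator (Measurable.sub ?_ ?_) (measurableSet_summable hg)
  · exact (measurable_tsum (g := fun a y => ENNReal.ofReal (g a y)) hg.ennreal_ofReal).ennreal_toReal
  · exact (measurable_tsum (g := fun a y => ENNReal.ofReal (-g a y))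
      hg.neg.ennreal_ofReal).ennreal_toReal

end Measurability

theorem measurable_cpair {f : EucSp d → ℝ} (hf : Measurable f) : Measurable (cpair (d := d) f) :=
  (measurable_real_tsum (X := Unit) (g := fun _ y => f y) (hf.comp measurable_snd)).comp
    ((measurable_const (a := ())).prodMk measurable_id)

/-- The condition under which the relative energy is finite. -/
def EnergyFinite (φ : EucSp d → EReal) (x : EucSp d) (γ : Config d) : Prop :=
  (∀ y ∈ γ.1, φ (x - y) ≠ ⊤) ∧ Summable (fun y : γ.1 => (φ (x - y.1)).toReal)

theorem measurableSet_energyFinite {φ : EucSp d → EReal} (hφ : Measurable φ) :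
    MeasurableSet {p : EucSp d × Config d | EnergyFinite φ p.1 p.2} := by
  have hsub : Measurable fun q : EucSp d × EucSp d => φ (q.1 - q.2) :=
    hφ.comp (measurable_fst.sub measurable_snd)
  refine MeasurableSet.inter ?_ (measurableSet_summable
    (g := fun x y => (φ (x - y)).toReal) hsub.ereal_toReal)
  have hA : MeasurableSet {q : EucSp d × EucSp d | φ (q.1 - q.2) = ⊤} :=
    hsub (measurableSet_singleton ⊤)
  have h := measurable_tsum (X := EucSp d)
    (g := fun x y => {q : EucSp d × EucSp d | φ (q.1 - q.2) = ⊤}.indicator 1 (x, y))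
    (measurable_one.indicator hA) (measurableSet_singleton 0)
  refine (congrArg MeasurableSet (Set.ext fun p => ?_)).mpr h
  change (∀ y ∈ p.2.1, φ (p.1 - y) ≠ ⊤) ↔ ∑' y : p.2.1, _ = 0
  simp [ENNReal.tsum_eq_zero, Set.indicator_apply]

theorem rexp_coe (r : ℝ) : rexp (r : EReal) = Real.exp r := by
  simp [rexp, eexp, ENNReal.toReal_ofReal (Real.exp_pos r).le]

theorem rexp_bot : rexp ⊥ = 0 := by simp [rexp, eexp]

theorem rexp_add {a b : EReal} (ha : a ≠ ⊤) (hb : b ≠ ⊤) : rexp (a + b) = rexp a * rexp b := by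
  induction a with
  | bot => simp [rexp_bot]
  | top => exact absurd rfl ha
  | coe a =>
    induction b with
    | bot => simp [rexp_bot]
    | top => exact absurd rfl hb
    | coe b => rw [← EReal.coe_add, rexp_coe, rexp_coe, rexp_coe, Real.exp_add]

theorem mul_energy_ne_top {φ : EucSp d → EReal} {c : ℝ} (hc : c < 0) (x : EucSp d)
    (γ : Config d) : (c : EReal) * energy φ x γ.1 ≠ ⊤ := by
  unfold energy
  split_ifs with h
  · rw [← EReal.coe_mul]; exact EReal.coe_ne_top _
  · rw [EReal.coe_mul_top_of_neg hc]; exact bot_ne_top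

theorem rexp_mul_energy {φ : EucSp d → EReal} {c : ℝ} (hc : c < 0) (x : EucSp d)
    (γ : Config d) : rexp ((c : EReal) * energy φ x γ.1)
      = if EnergyFinite φ x γ then Real.exp (c * ∑' y : γ.1, (φ (x - y.1)).toReal) else 0 := by
  unfold energy EnergyFinite
  split_ifs with h
  · rw [← EReal.coe_mul, rexp_coe]
  · rw [EReal.coe_mul_top_of_neg hc, rexp_bot]

theorem measurable_rexp_mul_energy {φ : EucSp d → EReal} (hφ : Measurable φ) {c : ℝ}
    (hc : c < 0) :
    Measurable fun p : EucSp d × Config d => rexp ((c : EReal) * energy φ p.1 p.2.1) := by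
  simp_rw [rexp_mul_energy hc]
  refine Measurable.ite (measurableSet_energyFinite hφ) ?_ measurable_const
  refine Real.measurable_exp.comp (Measurable.const_mul ?_ _)
  exact measurable_real_tsum (g := fun x y => (φ (x - y)).toReal)
    (hφ.comp (measurable_fst.sub measurable_snd)).ereal_toReal

theorem lintegral_prod_eq_pow {h : EucSp d → ℝ≥0∞} (hh : Measurable h) (n : ℕ) :
    ∫⁻ p : Fin n → EucSp d, ∏ i, h (p i) = (∫⁻ y, h y) ^ n := by
  induction n with
  | zero =>
    rw [MeasureTheory.volume_pi, Measure.pi_of_empty]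
    simp
  | succ n ih =>
    have e := volume_preserving_piFinSuccAbove (fun _ : Fin (n + 1) => EucSp d) 0
    have hm : Measurable fun p : Fin n → EucSp d => ∏ i, h (p i) :=
      Finset.measurable_prod _ fun i _ => hh.comp (measurable_pi_apply i)
    rw [pow_succ', ← ih, ← lintegral_prod_mul hh.aemeasurable hm.aemeasurable,
      ← Measure.volume_eq_prod, ← e.lintegral_comp
        (f := fun z : EucSp d × (Fin n → EucSp d) => h z.1 * ∏ i, h (z.2 i))
        ((hh.comp measurable_fst).mul (hm.comp measurable_snd))]
    refine lintegral_congr fun p => ?_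
    rw [Fin.prod_univ_succ]
    rfl

/-- The exponential moment bound implied by the Ruelle bound. -/
theorem lintegral_tuples_le {μ : Measure (Config d)} [IsProbabilityMeasure μ]
    {k : ∀ n : ℕ, (Fin n → EucSp d) → ℝ} (hk : HasCorrFns μ k) {ξ : ℝ} (hξ : 0 ≤ ξ)
    (hR : RuelleBound k ξ) {h : EucSp d → ℝ≥0∞} (hh : Measurable h) :
    ∫⁻ γ : Config d, ∑' n : ℕ, (n.factorial : ℝ≥0∞)⁻¹ *
        ∑' p : injTuples n γ.1, ∏ i, h (p.1 i) ∂μ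
      ≤ ∑' n : ℕ, (n.factorial : ℝ≥0∞)⁻¹ * (ENNReal.ofReal ξ * ∫⁻ y, h y) ^ n := by
  have hm : ∀ n : ℕ, Measurable fun p : Fin n → EucSp d => ∏ i, h (p i) := fun n =>
    Finset.measurable_prod _ fun i _ => hh.comp (measurable_pi_apply i)
  rw [lintegral_tsum fun n => ((measurable_tsum_injTuples n (hm n)).const_mul _).aemeasurable]
  refine ENNReal.tsum_le_tsum fun n => ?_
  rw [lintegral_const_mul _ (measurable_tsum_injTuples n (hm n))]
  gcongr
  rcases Nat.eq_zero_or_pos n with rfl | hn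
  · calc _ ≤ ∫⁻ _ : Config d, 1 ∂μ := by
          refine lintegral_mono fun γ => ?_
          refine (tsum_injTuples 0 γ fun p => ∏ i, h (p i)).trans_le ?_
          rw [tsum_fintype, Finset.univ_unique, Finset.sum_singleton]
          exact (Set.indicator_le_self _ _ _).trans (by simp)
      _ = _ := by simp
  · rw [hk.2 n hn _ (hm n) fun σ x => Equiv.prod_comp σ fun i => h (x i)]
    calc _ ≤ ∫⁻ x : Fin n → EucSp d, (∏ i, h (x i)) * ENNReal.ofReal ξ ^ n := by
          refine lintegral_mono fun x => ?_
          rw [← ENNReal.ofReal_pow hξ]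
          gcongr
          exact hR n hn x
      _ = _ := by
          rw [lintegral_mul_const _ (hm n), lintegral_prod_eq_pow hh, mul_pow, mul_comm]

theorem tsum_factorial_inv_mul_pow_ne_top {c : ℝ≥0∞} (hc : c ≠ ⊤) :
    ∑' n : ℕ, (n.factorial : ℝ≥0∞)⁻¹ * c ^ n ≠ ⊤ := by
  lift c to ℝ≥0 using hc
  have h : ∀ n : ℕ, (n.factorial : ℝ≥0∞)⁻¹ * (c : ℝ≥0∞) ^ n
      = ENNReal.ofReal ((c : ℝ) ^ n / n.factorial) := by
    intro n
    rw [ENNReal.ofReal_div_of_pos (by positivity), ENNReal.ofReal_pow c.coe_nonneg, ENNReal.ofReal_natCast,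
      ENNReal.ofReal_coe_nnreal, mul_comm, div_eq_mul_inv]
  simp_rw [h]
  rw [← ENNReal.ofReal_tsum_of_nonneg (fun n => by positivity)
    (Real.summable_pow_div_factorial (c : ℝ))]
  exact ENNReal.ofReal_ne_top

/-- The exponential of a sum over a configuration is dominated by the sum over tuples. -/
theorem exp_tsum_le (γ : Config d) {g : EucSp d → ℝ} {h : EucSp d → ℝ≥0∞}
    (hg : Summable fun y : γ.1 => g y)
    (hgh : ∀ y ∈ γ.1, ENNReal.ofReal (Real.exp (g y)) ≤ 1 + h y) :
    ENNReal.ofReal (Real.exp (∑' y : γ.1, g y))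
      ≤ ∑' n : ℕ, (n.factorial : ℝ≥0∞)⁻¹ * ∑' p : injTuples n γ.1, ∏ i, h (p.1 i) := by
  have ht : Tendsto (fun η : Finset γ.1 => ENNReal.ofReal (Real.exp (∑ y ∈ η, g y))) atTop
      (𝓝 (ENNReal.ofReal (Real.exp (∑' y : γ.1, g y)))) :=
    ENNReal.tendsto_ofReal ((Real.continuous_exp.tendsto _).comp hg.hasSum)
  refine le_of_tendsto' ht fun η => ?_
  rw [Real.exp_sum, ENNReal.ofReal_prod_of_nonneg fun _ _ => (Real.exp_pos _).le]
  exact (Finset.prod_le_prod' fun (y : γ.1) _ => hgh y.1 y.2).trans (prod_one_add_le γ h η)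

end Config

namespace Config

variable {d : ℕ}

/-- The absolute value `|e^{-φ} - 1|` of the Mayer function. -/
def absMayer (φ : EucSp d → EReal) (v : EucSp d) : ℝ := |rexp (-φ v) - 1|

theorem absMayer_nonneg (φ : EucSp d → EReal) (v : EucSp d) : 0 ≤ absMayer φ v := abs_nonneg _

theorem measurable_rexp : Measurable rexp := by
  unfold rexp eexp
  refine Measurable.ennreal_toReal ?_
  refine Measurable.ite (measurableSet_singleton _) measurable_const ?_
  refine Measurable.ite (measurableSet_singleton _) measurable_const ?_
  exact (Real.measurable_exp.comp measurable_id.ereal_toReal).ennreal_ofReal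

theorem measurable_absMayer {φ : EucSp d → EReal} (hφ : Measurable φ) :
    Measurable (absMayer φ) :=
  ((measurable_rexp.comp hφ.neg).sub_const 1).abs

theorem exp_neg_mul_le {φ : EucSp d → EReal} (hφ : ∀ x, φ x ≠ ⊥) {v : EucSp d} (hv : φ v ≠ ⊤)
    {t : ℝ} (ht0 : 0 ≤ t) (ht1 : t ≤ 1) :
    Real.exp (-t * (φ v).toReal) ≤ 1 + absMayer φ v := by
  have e : rexp (-φ v) = Real.exp (-(φ v).toReal) := by
    conv_lhs => rw [← EReal.coe_toReal hv (hφ v)]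
    rw [← EReal.coe_neg, rexp_coe]
  rcases le_total 0 (φ v).toReal with h | h
  · have : Real.exp (-t * (φ v).toReal) ≤ 1 := Real.exp_le_one_iff.2 (by nlinarith)
    linarith [absMayer_nonneg φ v]
  · have : Real.exp (-t * (φ v).toReal) ≤ Real.exp (-(φ v).toReal) :=
      Real.exp_le_exp.2 (by nlinarith)
    have h2 := le_abs_self (rexp (-φ v) - 1)
    rw [absMayer]
    linarith

theorem exists_absMayer_le {φ : EucSp d → EReal} (hφ : IsPairPotential φ) {B : ℝ}
    (hS : Stable φ B) : ∃ M : ℝ, 0 ≤ M ∧ ∀ v, absMayer φ v ≤ M := by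
  have key : ∀ v, v ≠ 0 → rexp (-φ v) ≤ Real.exp (2 * B) := by
    intro v hv
    have hr := EReal.coe_toReal (hφ.finite_off v hv) (hφ.ne_bot v)
    have h := hS {v, 0}
    rw [Finset.offDiag_insert (by simpa using hv)] at h
    have h0 : (v, (0 : EucSp d)) ≠ (0, v) := fun e => hv (congrArg Prod.fst e)
    simp only [Finset.offDiag_singleton, Finset.empty_union, Finset.singleton_product_singleton,
      Finset.card_pair hv] at h
    rw [Finset.sum_union (by simpa using h0), Finset.sum_singleton, Finset.sum_singleton,
      sub_zero, zero_sub, hφ.even v hv, ← hr, ← EReal.coe_add, EReal.coe_le_coe_iff] at h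
    rw [← hr, ← EReal.coe_neg, rexp_coe, Real.exp_le_exp]
    push_cast at h
    linarith
  refine ⟨Real.exp (2 * B) + 1 + |rexp (-φ 0) - 1|, by positivity, fun v => ?_⟩
  by_cases hv : v = 0
  · subst hv
    have := Real.exp_pos (2 * B)
    rw [absMayer]
    linarith
  · have h0 : 0 ≤ rexp (-φ v) := ENNReal.toReal_nonneg
    have h1 := key v hv
    have h2 := abs_nonneg (rexp (-φ 0) - 1)
    rw [absMayer, abs_le]
    constructor <;> linarith

theorem summable_of_hasCompactSupport {f : EucSp d → ℝ} (hf : HasCompactSupport f)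
    (γ : Config d) : Summable fun y : γ.1 => f y := by
  refine summable_of_hasFiniteSupport ?_
  have h : (Function.support fun y : γ.1 => f y) = Subtype.val ⁻¹' (γ.1 ∩ tsupport f ∩
      Function.support f) := by
    ext y
    simp only [Function.mem_support, Set.mem_preimage, Set.mem_inter_iff]
    exact ⟨fun h => ⟨⟨y.2, subset_tsupport _ h⟩, h⟩, fun h => h.2⟩
  change (Function.support fun y : γ.1 => f y).Finite
  rw [h]
  exact ((γ.2 _ hf).subset Set.inter_subset_left).preimage Subtype.val_injective.injOn

theorem exists_moment_bound {s z B ξ : ℝ} {φ : EucSp d → EReal} {μ : Measure (Config d)}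
    {k u : ∀ n : ℕ, (Fin n → EucSp d) → ℝ} (hset : Setting d s z B ξ φ μ k u)
    {f : EucSp d → ℝ} (hf : IsC0 f) :
    ∃ C : ℝ≥0∞, C ≠ ⊤ ∧ ∀ x, ∫⁻ γ, ENNReal.ofReal
      ((rexp (((s - 1 : ℝ) : EReal) * energy φ x γ.1) * Real.exp (cpair f γ)) ^ 2) ∂μ ≤ C := by
  have := hset.prob
  have hs0 := hset.hs0
  have hs1 := hset.hs1
  obtain ⟨M, hM0, hM⟩ := exists_absMayer_le hset.pp hset.stable
  set c : EucSp d → ℝ := fun y => |Real.exp (2 * f y) - 1| with hc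
  have hcc : Continuous c :=
    ((Real.continuous_exp.comp (continuous_const.mul hf.1)).sub continuous_const).abs
  have hcs : HasCompactSupport c := by
    refine hf.2.comp_left (g := fun r : ℝ => |Real.exp (2 * r) - 1|) ?_
    simp
  obtain ⟨L, hL⟩ := hcs.exists_bound_of_continuous hcc
  have hc0 : ∀ y, 0 ≤ c y := fun y => abs_nonneg _
  have hcL : ∀ y, c y ≤ L := fun y => (le_abs_self _).trans (hL y)
  have hL0 : 0 ≤ L := (hc0 0).trans (hcL 0)
  set K : ℝ := (2 + M) * (1 + L) with hK
  have hK0 : 0 ≤ K := by positivity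
  set h : EucSp d → EucSp d → ℝ≥0∞ := fun x y =>
    ENNReal.ofReal K * ENNReal.ofReal (absMayer φ (x - y)) + ENNReal.ofReal (c y) with hh
  have hma : Measurable fun v => ENNReal.ofReal (absMayer φ v) :=
    (measurable_absMayer hset.pp.meas).ennreal_ofReal
  have hmx : ∀ x, Measurable fun y => ENNReal.ofReal (absMayer φ (x - y)) := fun x =>
    hma.comp (measurable_const.sub measurable_id)
  have hhm : ∀ x, Measurable (h x) := fun x => ((hmx x).const_mul _).add
      hcc.measurable.ennreal_ofReal
  set I : ℝ≥0∞ := ENNReal.ofReal K * (∫⁻ v, ENNReal.ofReal (absMayer φ v))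
    + ∫⁻ y, ENNReal.ofReal (c y) with hI
  have hhI : ∀ x, ∫⁻ y, h x y = I := by
    intro x
    rw [hh, hI]
    simp only
    rw [lintegral_add_right _ hcc.measurable.ennreal_ofReal,
      lintegral_const_mul _ (hmx x),
      lintegral_sub_left_eq_self (fun v => ENNReal.ofReal (absMayer φ v)) x]
  have h_int : ∫⁻ v, ENNReal.ofReal (absMayer φ v) ≠ ⊤ := by
    have h1 := hset.laht.ne_top
    simp_rw [ENNReal.ofReal_mul (abs_nonneg _)] at h1
    change ∫⁻ v, ENNReal.ofReal (absMayer φ v) * ENNReal.ofReal z ≠ ⊤ at h1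
    rw [lintegral_mul_const _ hma] at h1
    intro h2
    have hz := hset.hz
    refine h1 ?_
    rw [h2, ENNReal.top_mul (by simpa using hz)]
  have hIt : I ≠ ⊤ := by
    refine ENNReal.add_ne_top.2 ⟨ENNReal.mul_ne_top ENNReal.ofReal_ne_top h_int, ?_⟩
    have := (hcc.integrable_of_hasCompactSupport hcs (μ := volume)).lintegral_lt_top
    exact this.ne
  refine ⟨_, tsum_factorial_inv_mul_pow_ne_top
    (ENNReal.mul_ne_top (ENNReal.ofReal_ne_top (r := ξ)) hIt), fun x => ?_⟩
  refine le_trans (lintegral_mono fun γ => ?_)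
    ((lintegral_tuples_le hset.corr hset.hξ.le hset.ruelle (hhm x)).trans (by rw [hhI]))
  rw [rexp_mul_energy (by linarith)]
  split_ifs with hE
  swap
  · simp
  have hsf := summable_of_hasCompactSupport hf.2 γ
  have heq : (Real.exp ((s - 1) * ∑' y : γ.1, (φ (x - y.1)).toReal) * Real.exp (cpair f γ)) ^ 2
      = Real.exp (∑' y : γ.1, (2 * ((s - 1) * (φ (x - y.1)).toReal) + 2 * f y)) := by
    rw [Summable.tsum_add ((hE.2.mul_left _).mul_left _) (hsf.mul_left _), tsum_mul_left,
      tsum_mul_left, tsum_mul_left, ← Real.exp_add, ← Real.exp_nat_mul, cpair]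
    congr 1
    push_cast
    ring
  rw [heq]
  refine exp_tsum_le γ (g := fun y => 2 * ((s - 1) * (φ (x - y)).toReal) + 2 * f y)
    (((hE.2.mul_left _).mul_left _).add (hsf.mul_left _)) fun y hy => ?_
  have ha0 := absMayer_nonneg φ (x - y)
  rw [hh]
  simp only
  rw [← ENNReal.ofReal_mul hK0, ← ENNReal.ofReal_add (by positivity) (hc0 y),
    ← ENNReal.ofReal_one, ← ENNReal.ofReal_add zero_le_one (by have := hc0 y; positivity)]
  refine ENNReal.ofReal_le_ofReal ?_
  have h1 := exp_neg_mul_le hset.pp.ne_bot (hE.1 y hy) (t := 1 - s) (by linarith) (by linarith)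
  have h2 : Real.exp (2 * f y) ≤ 1 + c y := by
    have := le_abs_self (Real.exp (2 * f y) - 1)
    rw [hc]
    simp only
    linarith
  have h3 : Real.exp (2 * ((s - 1) * (φ (x - y)).toReal))
      = Real.exp (-(1 - s) * (φ (x - y)).toReal) ^ 2 := by
    rw [← Real.exp_nat_mul]
    congr 1
    push_cast
    ring
  set a := absMayer φ (x - y)
  have haM : a ≤ M := hM _
  rw [Real.exp_add, h3]
  calc _ ≤ (1 + a) ^ 2 * (1 + c y) := by gcongr
    _ ≤ (1 + (2 + M) * a) * (1 + c y) := by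
        gcongr
        nlinarith
    _ ≤ 1 + (K * a + c y) := by
        have : (2 + M) * a * c y ≤ (2 + M) * a * L := by gcongr; exact hcL y
        rw [hK]
        nlinarith

end Config

namespace Config

variable {d : ℕ}

theorem cpair_ins {f : EucSp d → ℝ} (hf : HasCompactSupport f) {γ : Config d} {x : EucSp d}
    (hx : x ∉ γ.1) : cpair f (γ.ins x) = f x + cpair f γ := by
  change ∑' y : ↥(insert x γ.1), f y = _
  rw [Set.insert_eq, Summable.tsum_union_disjoint (f := f) (Set.disjoint_singleton_left.2 hx)
    (Summable.of_finite) (summable_of_hasCompactSupport hf γ), tsum_singleton]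
  rfl

/-- The integrand of the birth operator applied to `e^{⟨f,·⟩}`. -/
def birthDensity (s z : ℝ) (φ : EucSp d → EReal) (f : EucSp d → ℝ) (γ : Config d)
    (x : EucSp d) : ℝ :=
  z * (Real.exp (f x) - 1) *
    (rexp (((s - 1 : ℝ) : EReal) * energy φ x γ.1) * Real.exp (cpair f γ))

theorem H0Plus_exp_cpair (hd : 0 < d) (s z : ℝ) (φ : EucSp d → EReal) {f : EucSp d → ℝ}
    (hf : HasCompactSupport f) (γ : Config d) :
    H0Plus s z φ (fun γ' => Real.exp (cpair f γ')) γ = -∫ x, birthDensity s z φ f γ x := by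
  have : Nonempty (Fin d) := ⟨⟨0, hd⟩⟩
  have h0 : volume γ.1 = 0 := γ.countable.measure_zero _
  rw [H0Plus]
  congr 1
  refine integral_congr_ae ?_
  filter_upwards [measure_eq_zero_iff_ae_notMem.1 h0] with x hx
  rw [Dplus, cpair_ins hf hx, birthDensity, Real.exp_add]
  ring

theorem measurable_birthDensity {s : ℝ} (hs : s < 1) (z : ℝ) {φ : EucSp d → EReal}
    (hφ : Measurable φ) {f : EucSp d → ℝ} (hf : Measurable f) :
    Measurable fun p : Config d × EucSp d => birthDensity s z φ f p.1 p.2 := by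
  refine Measurable.mul ?_ (Measurable.mul ?_ ?_)
  · exact ((Real.measurable_exp.comp (hf.comp measurable_snd)).sub_const 1).const_mul z
  · exact (measurable_rexp_mul_energy hφ (by linarith)).comp measurable_swap
  · exact Real.measurable_exp.comp ((measurable_cpair hf).comp measurable_fst)

theorem integrable_birthDensity_mul {s z B ξ : ℝ} {φ : EucSp d → EReal} {μ : Measure (Config d)}
    {k u : ∀ n : ℕ, (Fin n → EucSp d) → ℝ} (hset : Setting d s z B ξ φ μ k u)
    {f : EucSp d → ℝ} (hf : IsC0 f) :
    Integrable (fun p : Config d × (EucSp d × EucSp d) =>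
      birthDensity s z φ f p.1 p.2.1 * birthDensity s z φ f p.1 p.2.2)
      (μ.prod (volume.prod volume)) := by
  have := hset.prob
  have hs : s < 1 := by linarith [hset.hs1]
  have hm := measurable_birthDensity hs z hset.pp.meas hf.1.measurable
  have hm1 : Measurable fun p : Config d × (EucSp d × EucSp d) => birthDensity s z φ f p.1 p.2.1 :=
    hm.comp (measurable_fst.prodMk (measurable_fst.comp measurable_snd))
  have hm2 : Measurable fun p : Config d × (EucSp d × EucSp d) => birthDensity s z φ f p.1 p.2.2 :=
    hm.comp (measurable_fst.prodMk (measurable_snd.comp measurable_snd))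
  have hm12 : Measurable fun p : Config d × (EucSp d × EucSp d) =>
      birthDensity s z φ f p.1 p.2.1 * birthDensity s z φ f p.1 p.2.2 := hm1.mul hm2
  obtain ⟨C, hC, hmom⟩ := exists_moment_bound hset hf
  refine ⟨hm12.aestronglyMeasurable, ?_⟩
  rw [hasFiniteIntegral_iff_enorm, lintegral_prod_symm _ hm12.enorm.aemeasurable]
  set W : EucSp d → ℝ := fun x => z * (Real.exp (f x) - 1) with hW
  have hWc : Continuous W :=
    continuous_const.mul ((Real.continuous_exp.comp hf.1).sub continuous_const)
  have hWs : HasCompactSupport W :=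
    hf.2.comp_left (g := fun r : ℝ => z * (Real.exp r - 1)) (by simp)
  have hWi : ∫⁻ x, ‖W x‖ₑ < ⊤ := (hWc.integrable_of_hasCompactSupport hWs).hasFiniteIntegral
  set G : EucSp d → Config d → ℝ := fun x γ =>
    rexp (((s - 1 : ℝ) : EReal) * energy φ x γ.1) * Real.exp (cpair f γ) with hG
  have hGm : ∀ x, Measurable fun γ => ENNReal.ofReal (G x γ ^ 2) := by
    intro x
    have h1 : Measurable fun γ : Config d => rexp (((s - 1 : ℝ) : EReal) * energy φ x γ.1) :=
      (measurable_rexp_mul_energy hset.pp.meas (c := s - 1) (by linarith)).comp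
        measurable_prodMk_left
    exact ((h1.mul (Real.measurable_exp.comp
      (measurable_cpair hf.1.measurable))).pow_const 2).ennreal_ofReal
  have hpt : ∀ (p : EucSp d × EucSp d) (γ : Config d),
      ‖birthDensity s z φ f γ p.1 * birthDensity s z φ f γ p.2‖ₑ
        ≤ ‖W p.1‖ₑ * ‖W p.2‖ₑ *
          (ENNReal.ofReal (G p.1 γ ^ 2) + ENNReal.ofReal (G p.2 γ ^ 2)) := by
    intro p γ
    have e : birthDensity s z φ f γ p.1 * birthDensity s z φ f γ p.2
        = W p.1 * W p.2 * (G p.1 γ * G p.2 γ) := by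
      simp only [birthDensity, hW, hG]
      ring
    rw [e, enorm_mul, enorm_mul, ← ENNReal.ofReal_add (sq_nonneg _) (sq_nonneg _)]
    gcongr
    rw [Real.enorm_eq_ofReal_abs, abs_mul]
    refine ENNReal.ofReal_le_ofReal ?_
    nlinarith [sq_nonneg (|G p.1 γ| - |G p.2 γ|), sq_abs (G p.1 γ), sq_abs (G p.2 γ),
      sq_nonneg (G p.1 γ), sq_nonneg (G p.2 γ)]
  calc _ ≤ ∫⁻ p : EucSp d × EucSp d, ‖W p.1‖ₑ * ‖W p.2‖ₑ * (C + C) ∂(volume.prod volume) := by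
        refine lintegral_mono fun p => ?_
        refine (lintegral_mono fun γ => hpt p γ).trans ?_
        rw [lintegral_const_mul' _ _ (ENNReal.mul_ne_top enorm_ne_top enorm_ne_top),
          lintegral_add_left (hGm _)]
        gcongr
        · exact hmom p.1
        · exact hmom p.2
    _ = (∫⁻ x, ‖W x‖ₑ) * (∫⁻ x, ‖W x‖ₑ) * (C + C) := by
        rw [lintegral_mul_const, lintegral_prod_mul hWc.enorm.aemeasurable
          hWc.enorm.aemeasurable]
        exact (hWc.enorm.measurable.comp measurable_fst).mul
          (hWc.enorm.measurable.comp measurable_snd)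
    _ < ⊤ := ENNReal.mul_lt_top (ENNReal.mul_lt_top hWi hWi)
        (ENNReal.add_lt_top.2 ⟨hC.lt_top, hC.lt_top⟩)

end Config

/-- explicit formula for `∫_Γ (H_0^+ F)² dμ` with `F = e^{⟨f,·⟩}`. -/
theorem statement14 (d : ℕ) (s z B ξ : ℝ) (φ : EucSp d → EReal) (μ : Measure (Config d))
    (k u : ∀ n : ℕ, (Fin n → EucSp d) → ℝ) (hset : Setting d s z B ξ φ μ k u)
    (f : EucSp d → ℝ) (hf : IsC0 f) :
    ∫ γ, (H0Plus s z φ (fun γ' => Real.exp (cpair f γ')) γ) ^ 2 ∂μ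
      = ∫ x₁ : EucSp d, ∫ x₂ : EucSp d,
          z * z * (Real.exp (f x₁) - 1) * (Real.exp (f x₂) - 1) *
          ∫ γ, rexp (((s - 1 : ℝ) : EReal) * energy φ x₁ γ.1 +
            ((s - 1 : ℝ) : EReal) * energy φ x₂ γ.1 +
            ((2 * cpair f γ : ℝ) : EReal)) ∂μ := by
  have := hset.prob
  have hs : s - 1 < 0 := by linarith [hset.hs1]
  have h_int := Config.integrable_birthDensity_mul hset hf
  have hsq : ∀ γ, (H0Plus s z φ (fun γ' => Real.exp (cpair f γ')) γ) ^ 2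
      = ∫ p : EucSp d × EucSp d, Config.birthDensity s z φ f γ p.1 *
        Config.birthDensity s z φ f γ p.2 ∂(volume.prod volume) := by
    intro γ
    rw [Config.H0Plus_exp_cpair hset.hd s z φ hf.2, integral_prod_mul, neg_sq, sq]
  simp_rw [hsq]
  rw [integral_integral_swap (f := fun γ (p : EucSp d × EucSp d) =>
    Config.birthDensity s z φ f γ p.1 * Config.birthDensity s z φ f γ p.2) h_int,
    integral_prod _ h_int.integral_prod_right]
  refine integral_congr_ae (Eventually.of_forall fun x₁ => integral_congr_ae
    (Eventually.of_forall fun x₂ => ?_))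
  simp only
  rw [← integral_const_mul]
  refine integral_congr_ae (Eventually.of_forall fun γ => ?_)
  have h1 := Config.mul_energy_ne_top (φ := φ) hs x₁ γ
  have h2 := Config.mul_energy_ne_top (φ := φ) hs x₂ γ
  simp only
  rw [Config.rexp_add (EReal.add_lt_top h1 h2).ne (EReal.coe_ne_top _), Config.rexp_add h1 h2,
    Config.rexp_coe, two_mul, Real.exp_add, Config.birthDensity, Config.birthDensity]
  ring

end
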